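/- There exist k pairwise vertex-disjoint paths P_1, …, P_k in G, with P_i having endpoints s_i and t_i, if and only if G' has a clique minor of order n + 1. -/

import Mathlib

/-- A vertex of `G` is a terminal: one of the `s i` or `t i`. -/
def IsTerminal {V : Type*} {k : ℕ} (s t : Fin k → V) (v : V) : Prop :=
  (∃ i, v = s i) ∨ (∃ i, v = t i)

/-- Generating relation for the edges of `G'` in the disjoint-paths reduction: all edges of
`G`; all pairs of distinct new vertices (the set `W`, modelled by `Fin m`); all pairs of a
new vertex and a terminal; and all pairs of distinct terminals except the pairs `{s i, t i}`. -/
def dpRel {V : Type*} {k : ℕ} (G : SimpleGraph V) (s t : Fin k → V) (m : ℕ) :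
    (V ⊕ Fin m) → (V ⊕ Fin m) → Prop
  | Sum.inl u, Sum.inl w => G.Adj u w ∨
      (IsTerminal s t u ∧ IsTerminal s t w ∧
        ¬ ∃ i, (u = s i ∧ w = t i) ∨ (u = t i ∧ w = s i))
  | Sum.inl u, Sum.inr _ => IsTerminal s t u
  | Sum.inr _, Sum.inr _ => True
  | Sum.inr _, Sum.inl _ => False

/-- The graph `G'` of the disjoint-paths reduction: `G` together with an `(n+1)`-clique on
`W ∪ {terminals}` from which the `k` edges `s i t i` have been removed. -/
def Gdp {V : Type*} {k : ℕ} (G : SimpleGraph V) (s t : Fin k → V) (m : ℕ) :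
    SimpleGraph (V ⊕ Fin m) :=
  SimpleGraph.fromRel (dpRel G s t m)

/-- The `n + 1` vertices `Q = W ∪ {s_1, t_1, …, s_k, t_k}` spanning the clique part. -/
def cliquePart {V : Type*} {k : ℕ} (s t : Fin k → V) (m : ℕ) : Set (V ⊕ Fin m) :=
  {x | (∃ w : Fin m, x = Sum.inr w) ∨ ∃ u : V, x = Sum.inl u ∧ IsTerminal s t u}

/-- A clique minor of order `h` in `H`, given as a family of `h` pairwise disjoint nonempty
vertex subsets, each inducing a connected subgraph, with an edge of `H` between every two
of the subsets. -/
def IsCliqueMinorFam {V : Type*} (H : SimpleGraph V) {h : ℕ} (S : Fin h → Set V) : Prop :=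
  (∀ i, (S i).Nonempty) ∧
  (∀ i, (H.induce (S i)).Connected) ∧
  (∀ i j, i ≠ j → Disjoint (S i) (S j)) ∧
  (∀ i j, i ≠ j → ∃ u ∈ S i, ∃ v ∈ S j, H.Adj u v)

lemma Gdp_adj_inl {V : Type*} {k : ℕ} (G : SimpleGraph V) (s t : Fin k → V) (m : ℕ) (u v : V) :
    (Gdp G s t m).Adj (Sum.inl u) (Sum.inl v) ↔ G.Adj u v ∨ (u ≠ v ∧
      IsTerminal s t u ∧ IsTerminal s t v ∧
        ¬ ∃ i, (u = s i ∧ v = t i) ∨ (u = t i ∧ v = s i)) := by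
  simp only [Gdp, SimpleGraph.fromRel_adj, dpRel, ne_eq, Sum.inl.injEq]
  constructor
  · rintro ⟨h, (h1 | h1) | (h1 | ⟨h1, h2, h3⟩)⟩
    · exact Or.inl h1
    · exact Or.inr ⟨h, h1⟩
    · exact Or.inl h1.symm
    · refine Or.inr ⟨h, h2, h1, ?_⟩
      rintro ⟨i, ⟨a, b⟩ | ⟨a, b⟩⟩
      · exact h3 ⟨i, Or.inr ⟨b, a⟩⟩
      · exact h3 ⟨i, Or.inl ⟨b, a⟩⟩
  · rintro (h | ⟨h, h1⟩)
    · exact ⟨h.ne, Or.inl (Or.inl h)⟩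
    · exact ⟨h, Or.inl (Or.inr h1)⟩

lemma Gdp_adj_inl_inr {V : Type*} {k : ℕ} (G : SimpleGraph V) (s t : Fin k → V) (m : ℕ) (u : V)
    (w : Fin m) :
    (Gdp G s t m).Adj (Sum.inl u) (Sum.inr w) ↔ IsTerminal s t u := by
  simp [Gdp, SimpleGraph.fromRel_adj, dpRel]

lemma Gdp_adj_inr {V : Type*} {k : ℕ} (G : SimpleGraph V) (s t : Fin k → V) (m : ℕ)
    (w w' : Fin m) :
    (Gdp G s t m).Adj (Sum.inr w) (Sum.inr w') ↔ w ≠ w' := by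
  simp [Gdp, SimpleGraph.fromRel_adj, dpRel]

/-- The clique part, parametrised. -/
def dpHub {V : Type*} {k : ℕ} (s t : Fin k → V) (m : ℕ) :
    (Fin m ⊕ (Fin k ⊕ Fin k)) → V ⊕ Fin m
  | Sum.inl w => Sum.inr w
  | Sum.inr x => Sum.inl (Sum.elim s t x)

lemma dpHub_inj {V : Type*} {k : ℕ} (s t : Fin k → V) (m : ℕ)
    (hdist : Function.Injective (Sum.elim s t)) : Function.Injective (dpHub s t m) := by
  rintro (w | x) (w' | x') h
  · simpa [dpHub] using h
  · simp [dpHub] at h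
  · simp [dpHub] at h
  · simp only [dpHub, Sum.inl.injEq] at h
    rw [hdist h]

lemma isTerminal_iff {V : Type*} {k : ℕ} (s t : Fin k → V) (v : V) :
    IsTerminal s t v ↔ ∃ x, v = Sum.elim s t x := by
  simp [IsTerminal, Sum.exists]

lemma walk_of_induced {V : Type*} {k : ℕ} (G : SimpleGraph V) (s t : Fin k → V) (m : ℕ)
    (A : Set (V ⊕ Fin m)) (hA : ∀ x ∈ A, ∃ v, x = Sum.inl v)
    (hG : ∀ u v, Sum.inl u ∈ A → Sum.inl v ∈ A →
      (Gdp G s t m).Adj (Sum.inl u) (Sum.inl v) → G.Adj u v)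
    (x y : A) (p : ((Gdp G s t m).induce A).Walk x y) :
    ∀ u v, x.1 = Sum.inl u → y.1 = Sum.inl v →
      ∃ q : G.Walk u v, ∀ w ∈ q.support, Sum.inl w ∈ A := by
  induction p with
  | nil =>
    rename_i x
    intro u v h1 h2
    obtain rfl : u = v := Sum.inl_injective (h1.symm.trans h2)
    refine ⟨SimpleGraph.Walk.nil, ?_⟩
    intro w hw
    simp only [SimpleGraph.Walk.support_nil, List.mem_singleton] at hw
    subst hw
    rw [← h1]; exact x.2
  | cons hadj p ih =>
    rename_i a b c
    intro u v h1 h2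
    obtain ⟨b', hb'⟩ := hA b.1 b.2
    obtain ⟨q, hq⟩ := ih b' v hb' h2
    have hu : Sum.inl u ∈ A := h1 ▸ a.2
    have hb : Sum.inl b' ∈ A := hb' ▸ b.2
    have had : (Gdp G s t m).Adj a.1 b.1 := hadj
    rw [h1, hb'] at had
    refine ⟨SimpleGraph.Walk.cons (hG u b' hu hb had) q, ?_⟩
    intro w hw
    rw [SimpleGraph.Walk.support_cons, List.mem_cons] at hw
    rcases hw with rfl | hw
    · exact hu
    · exact hq w hw

lemma backward {V : Type*} [Fintype V] (G : SimpleGraph V) (k : ℕ) (s t : Fin k → V) (m : ℕ)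
    (hdist : Function.Injective (Sum.elim s t))
    (hm : m + 2 * k = Fintype.card V + 1)
    (S : Fin (Fintype.card V + 1) → Set (V ⊕ Fin m))
    (hS : IsCliqueMinorFam (Gdp G s t m) S) :
    ∃ P : ∀ i : Fin k, G.Walk (s i) (t i),
        (∀ i, (P i).IsPath) ∧
          ∀ i j, i ≠ j → ∀ v, v ∈ (P i).support → v ∉ (P j).support := by
  classical
  obtain ⟨hne, hconn, hdisj, hadj⟩ := hS
  have huniq : ∀ {a b x}, x ∈ S a → x ∈ S b → a = b := by
    intro a b x h1 h2
    by_contra h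
    exact Set.disjoint_left.mp (hdisj a b h) h1 h2
  have hhub : ∀ a, ∃ x, dpHub s t m x ∈ S a := by
    intro a
    by_contra hno
    push Not at hno
    have key : ∀ b, ∃ v : V, Sum.inl v ∈ S b := by
      intro b
      by_cases hb : a = b
      · subst hb
        obtain ⟨x, hx⟩ := hne a
        rcases x with v | w
        · exact ⟨v, hx⟩
        · exact absurd hx (hno (Sum.inl w))
      · obtain ⟨u, hu, v, hv, huv⟩ := hadj a b hb
        rcases v with v | w
        · exact ⟨v, hv⟩
        · rcases u with u | w'
          · rw [Gdp_adj_inl_inr, isTerminal_iff] at huv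
            obtain ⟨x, rfl⟩ := huv
            exact absurd hu (hno (Sum.inr x))
          · exact absurd hu (hno (Sum.inl w'))
    choose f hf using key
    have hfi : Function.Injective f := by
      intro b c hbc
      exact huniq (hf b) (hbc ▸ hf c)
    have := Fintype.card_le_of_injective f hfi
    simp at this
  choose f hf using hhub
  have hfi : Function.Injective f := by
    intro b c hbc
    exact huniq (hf b) (hbc ▸ hf c)
  have hfb : Function.Bijective f := by
    rw [Fintype.bijective_iff_injective_and_card]
    refine ⟨hfi, ?_⟩
    simp
    omega
  have hfu : ∀ a x, dpHub s t m x ∈ S a → f a = x := by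
    intro a x hx
    obtain ⟨b, rfl⟩ := hfb.2 x
    rw [huniq hx (hf b)]
  choose g hg using hfb.2
  have hgS : ∀ x, dpHub s t m x ∈ S (g x) := fun x => by
    have := hf (g x); rwa [hg] at this
  -- the sets containing terminals
  have hinl : ∀ z : Fin k ⊕ Fin k, ∀ x ∈ S (g (Sum.inr z)), ∃ v, x = Sum.inl v := by
    intro z x hx
    rcases x with v | w
    · exact ⟨v, rfl⟩
    · have := hfu _ (Sum.inl w) hx
      rw [hg] at this
      cases this
  have hterm : ∀ z : Fin k ⊕ Fin k, ∀ v, Sum.inl v ∈ S (g (Sum.inr z)) → IsTerminal s t v →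
      v = Sum.elim s t z := by
    intro z v hv ht
    rw [isTerminal_iff] at ht
    obtain ⟨x, rfl⟩ := ht
    have := hfu _ (Sum.inr x) hv
    rw [hg] at this
    cases this
    rfl
  have hwalk : ∀ z : Fin k ⊕ Fin k, ∀ v, Sum.inl v ∈ S (g (Sum.inr z)) →
      ∃ q : G.Walk (Sum.elim s t z) v, ∀ w ∈ q.support, Sum.inl w ∈ S (g (Sum.inr z)) := by
    intro z v hv
    obtain ⟨p⟩ := (hconn (g (Sum.inr z))).preconnected ⟨_, hgS (Sum.inr z)⟩ ⟨_, hv⟩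
    refine walk_of_induced G s t m _ (hinl z) ?_ _ _ p _ _ rfl rfl
    intro u v hu hv huv
    rw [Gdp_adj_inl] at huv
    rcases huv with h | ⟨h, h1, h2, -⟩
    · exact h
    · exact absurd ((hterm z u hu h1).trans (hterm z v hv h2).symm) h
  have hpath : ∀ i : Fin k, ∃ p : G.Walk (s i) (t i), p.IsPath ∧ ∀ w ∈ p.support,
      Sum.inl w ∈ S (g (Sum.inr (Sum.inl i))) ∨ Sum.inl w ∈ S (g (Sum.inr (Sum.inr i))) := by
    intro i
    have hgi : g (Sum.inr (Sum.inl i)) ≠ g (Sum.inr (Sum.inr i)) := by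
      intro h
      have := congrArg f h
      simp [hg] at this
    obtain ⟨u, hu, v, hv, huv⟩ := hadj _ _ hgi
    obtain ⟨u, rfl⟩ := hinl _ u hu
    obtain ⟨v, rfl⟩ := hinl _ v hv
    have hG : G.Adj u v := by
      rw [Gdp_adj_inl] at huv
      rcases huv with h | ⟨h, h1, h2, h3⟩
      · exact h
      · exact absurd ⟨i, Or.inl ⟨hterm _ u hu h1, hterm _ v hv h2⟩⟩ h3
    obtain ⟨p, hp⟩ := hwalk _ u hu
    obtain ⟨q, hq⟩ := hwalk _ v hv
    change G.Walk (s i) u at p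
    change G.Walk (t i) v at q
    let r : G.Walk (s i) (t i) := p.append (SimpleGraph.Walk.cons hG q.reverse)
    refine ⟨r.bypass, r.bypass_isPath, ?_⟩
    intro w hw
    have hw' : w ∈ r.support := r.support_bypass_subset_support hw
    simp only [Sum.elim_inl, Sum.elim_inr, r, SimpleGraph.Walk.mem_support_append_iff, SimpleGraph.Walk.support_cons,
      List.mem_cons, SimpleGraph.Walk.support_reverse, List.mem_reverse] at hw'
    rcases hw' with h | rfl | h
    · exact Or.inl (hp w h)
    · exact Or.inl hu
    · exact Or.inr (hq w h)
  choose P hP hPs using hpath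
  refine ⟨P, hP, ?_⟩
  intro i j hij v hvi hvj
  have aux : ∀ z z', Sum.inl v ∈ S (g (Sum.inr z)) → Sum.inl v ∈ S (g (Sum.inr z')) → z = z' := by
    intro z z' h1 h2
    have := congrArg f (huniq h1 h2)
    simpa [hg] using this
  rcases hPs i v hvi with h1 | h1 <;> rcases hPs j v hvj with h2 | h2 <;>
    have := aux _ _ h1 h2 <;> simp at this <;> exact hij this

/-- Branch sets for the forward direction. -/
def dpBranch {V : Type*} {k : ℕ} {G : SimpleGraph V} {s t : Fin k → V} (m : ℕ)
    (P : ∀ i : Fin k, G.Walk (s i) (t i)) :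
    (Fin m ⊕ (Fin k ⊕ Fin k)) → Set (V ⊕ Fin m)
  | Sum.inl w => {Sum.inr w}
  | Sum.inr (Sum.inl i) => Sum.inl '' {v | v ∈ (P i).support ∧ v ≠ t i}
  | Sum.inr (Sum.inr i) => {Sum.inl (t i)}

lemma connected_singleton_aux {V : Type*} (H : SimpleGraph V) (v : V) :
    (H.induce {v}).Connected := by
  refine SimpleGraph.induce_connected_of_patches v rfl ?_
  rintro _ rfl
  exact ⟨_, subset_rfl, rfl, rfl, SimpleGraph.Reachable.refl _⟩

lemma forward {V : Type*} [Fintype V] (G : SimpleGraph V) (k : ℕ) (s t : Fin k → V) (m : ℕ)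
    (hdist : Function.Injective (Sum.elim s t))
    (hm : m + 2 * k = Fintype.card V + 1)
    (P : ∀ i : Fin k, G.Walk (s i) (t i)) (hP : ∀ i, (P i).IsPath)
    (hPd : ∀ i j, i ≠ j → ∀ v, v ∈ (P i).support → v ∉ (P j).support) :
    ∃ S : Fin (Fintype.card V + 1) → Set (V ⊕ Fin m), IsCliqueMinorFam (Gdp G s t m) S := by
  classical
  have hst : ∀ i j, s i ≠ t j := by
    intro i j h
    have := @hdist (Sum.inl i) (Sum.inr j) h
    cases this
  have hhub : ∀ x, dpHub s t m x ∈ dpBranch m P x := by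
    rintro (w | i | i)
    · simp [dpHub, dpBranch]
    · exact ⟨s i, ⟨(P i).start_mem_support, hst i i⟩, rfl⟩
    · simp [dpHub, dpBranch]
  have hconn : ∀ x, ((Gdp G s t m).induce (dpBranch m P x)).Connected := by
    rintro (w | i | i)
    · exact connected_singleton_aux _ _
    · let φ : G →g Gdp G s t m := ⟨Sum.inl, fun {u v} h => (Gdp_adj_inl G s t m u v).2 (Or.inl h)⟩
      refine SimpleGraph.induce_connected_of_patches (Sum.inl (s i))
        (hhub (Sum.inr (Sum.inl i))) ?_
      rintro _ ⟨v, ⟨hv, hvt⟩, rfl⟩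
      let q := ((P i).takeUntil v hv).map φ
      refine ⟨{x | x ∈ q.support}, ?_, q.start_mem_support, q.end_mem_support,
        q.connected_induce_support.preconnected _ _⟩
      intro x hx
      simp only [q, SimpleGraph.Walk.support_map, Set.mem_ofPred_eq, List.mem_map] at hx
      obtain ⟨y, hy, rfl⟩ := hx
      refine ⟨y, ⟨(P i).support_takeUntil_subset_support hv hy, ?_⟩, rfl⟩
      rintro rfl
      exact SimpleGraph.Walk.endpoint_notMem_support_takeUntil (hP i) hv hvt.symm hy
    · exact connected_singleton_aux _ _
  have hdisj : ∀ x y, x ≠ y → Disjoint (dpBranch m P x) (dpBranch m P y) := by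
    intro x y hxy
    rw [Set.disjoint_left]
    intro a ha hb
    apply hxy
    have hPP : ∀ i j v, v ∈ (P i).support → v ∈ (P j).support → i = j := by
      intro i j v h1 h2
      by_contra h
      exact hPd i j h v h1 h2
    rcases x with w | i | i <;> rcases y with w' | j | j <;> rcases a with a | a <;>
      simp [dpBranch] at ha hb ⊢
    · exact ha.symm.trans hb
    · exact hPP i j a ha.1 hb.1
    · subst hb
      obtain rfl := hPP i j _ ha.1 (P j).end_mem_support
      exact ha.2 rfl
    · subst ha
      obtain rfl := hPP i j _ (P i).end_mem_support hb.1
      exact hb.2 rfl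
    · subst ha
      simpa using @hdist (Sum.inr i) (Sum.inr j) (by simp [hb])
  have hsep : ∀ i, ∃ u ∈ dpBranch m P (Sum.inr (Sum.inl i)),
      ∃ v ∈ dpBranch m P (Sum.inr (Sum.inr i)), (Gdp G s t m).Adj u v := by
    intro i
    have hnil : ¬ (P i).Nil := SimpleGraph.Walk.not_nil_of_ne (hst i i)
    have had := (P i).adj_penultimate hnil
    exact ⟨Sum.inl (P i).penultimate, ⟨_, ⟨(P i).getVert_mem_support _, had.ne⟩, rfl⟩,
      Sum.inl (t i), rfl, (Gdp_adj_inl G s t m _ _).2 (Or.inl had)⟩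
  have hadj : ∀ x y, x ≠ y → ∃ u ∈ dpBranch m P x, ∃ v ∈ dpBranch m P y,
      (Gdp G s t m).Adj u v := by
    intro x y hxy
    by_cases hh : (Gdp G s t m).Adj (dpHub s t m x) (dpHub s t m y)
    · exact ⟨_, hhub x, _, hhub y, hh⟩
    rcases x with w | x <;> rcases y with w' | y
    · exact absurd ((Gdp_adj_inr G s t m _ _).2 (fun h => hxy (by rw [h]))) hh
    · exact absurd ((Gdp_adj_inl_inr G s t m _ _).2 ((isTerminal_iff s t _).2 ⟨y, rfl⟩)).symm hh
    · exact absurd ((Gdp_adj_inl_inr G s t m _ _).2 ((isTerminal_iff s t _).2 ⟨x, rfl⟩)) hh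
    · simp only [dpHub, Gdp_adj_inl] at hh
      push Not at hh
      obtain ⟨i, ⟨h1, h2⟩ | ⟨h1, h2⟩⟩ := hh.2 (fun h => hxy (by rw [hdist h]))
        ((isTerminal_iff s t _).2 ⟨x, rfl⟩) ((isTerminal_iff s t _).2 ⟨y, rfl⟩)
      · obtain rfl := @hdist x (Sum.inl i) h1
        obtain rfl := @hdist y (Sum.inr i) h2
        exact hsep i
      · obtain rfl := @hdist x (Sum.inr i) h1
        obtain rfl := @hdist y (Sum.inl i) h2
        obtain ⟨u, hu, v, hv, huv⟩ := hsep i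
        exact ⟨v, hv, u, hu, huv.symm⟩
  have e : Fin (Fintype.card V + 1) ≃ (Fin m ⊕ (Fin k ⊕ Fin k)) :=
    Fintype.equivOfCardEq (by simp; omega)
  exact ⟨fun a => dpBranch m P (e a), fun a => ⟨_, hhub _⟩, fun a => hconn _,
    fun a b hab => hdisj _ _ (e.injective.ne hab), fun a b hab => hadj _ _ (e.injective.ne hab)⟩

/-- `G` contains `k` pairwise vertex-disjoint paths joining `s i` to `t i` if and only if
`G'` has a clique minor of order `n + 1`. -/
theorem stmt13 {V : Type*} [Fintype V] (G : SimpleGraph V) (k : ℕ) (s t : Fin k → V)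
    (hdist : Function.Injective (Sum.elim s t))
    (hk : 2 * k ≤ Fintype.card V + 1) :
    (∃ P : ∀ i : Fin k, G.Walk (s i) (t i),
        (∀ i, (P i).IsPath) ∧
          ∀ i j, i ≠ j → ∀ v, v ∈ (P i).support → v ∉ (P j).support) ↔
      (∃ S : Fin (Fintype.card V + 1) → Set (V ⊕ Fin (Fintype.card V + 1 - 2 * k)),
        IsCliqueMinorFam (Gdp G s t (Fintype.card V + 1 - 2 * k)) S) := by
  constructor
  · rintro ⟨P, hP, hPd⟩
    exact forward G k s t _ hdist (by omega) P hP hPd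
  · rintro ⟨S, hS⟩
    exact backward G k s t _ hdist (by omega) S hS
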